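/- Let q = p^f be a power of an odd prime p and let L = PSL(6, 𝔽_q). Then the least common multiple of the orders of elements of L that are coprime to p equals (q⁶−1)(q⁵−1)(q²+1)/(q−1); that is, exp_{p'}(L) = (q⁶−1)(q⁵−1)(q²+1)/(q−1). -/

import Mathlib

open scoped MatrixGroups

/-- The spectrum of a group: the set of orders of its elements. -/
def specSet (G : Type*) [Group G] : Set ℕ := {n | ∃ g : G, orderOf g = n}

section Divisibility

theorem mul_mul_dvd_of_isCoprime {a b c D : ℤ} (ha : a ≠ 0) (hb : a * b ∣ D) (hc : a * c ∣ D)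
    (h : IsCoprime b c) : a * (b * c) ∣ D := by
  obtain ⟨D', rfl⟩ := (dvd_mul_right a b).trans hb
  rw [mul_dvd_mul_iff_left ha] at *
  exact h.mul_dvd hb hc

theorem mul_dvd_of_dvd_of_mul_dvd_mul {a b k D : ℤ} (ha : a ≠ 0) (haD : a ∣ D)
    (h : a * b ∣ k * D) (hk : IsCoprime b k) : a * b ∣ D := by
  obtain ⟨D', rfl⟩ := haD
  rw [mul_left_comm, mul_dvd_mul_iff_left ha] at h
  exact mul_dvd_mul_left a (hk.dvd_of_dvd_mul_left h)

theorem isCoprime_cyclotomic_five_six {q : ℤ} (hq : Odd q) :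
    IsCoprime (q ^ 4 + q ^ 3 + q ^ 2 + q + 1) 6 := by
  have key : (q ^ 4 + q ^ 3 + q ^ 2 + q + 1) % 6 = 1 ∨
      (q ^ 4 + q ^ 3 + q ^ 2 + q + 1) % 6 = 5 := by
    have h : q % 6 = 1 ∨ q % 6 = 3 ∨ q % 6 = 5 := by
      obtain ⟨k, rfl⟩ := hq
      omega
    rcases h with h | h | h <;> simp [Int.add_emod, pow_succ, Int.mul_emod, h]
  generalize q ^ 4 + q ^ 3 + q ^ 2 + q + 1 = x at key
  rcases key with h | h
  · exact ⟨1, -(x / 6), by omega⟩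
  · exact ⟨-1, x / 6 + 1, by omega⟩

/-- The product of the first six cyclotomic polynomials at `q` divides `D` as soon as `D` is a
multiple, up to small factors, of four products of some of them. -/
theorem prod_cyclotomic_dvd {q D : ℤ} (hq : Odd q) (hq1 : 1 < q) (h4 : q ^ 4 - 1 ∣ D)
    (h3 : q ^ 3 - 1 ∣ D) (h5 : q ^ 5 - 1 ∣ 6 * D) (h6 : q ^ 3 + 1 ∣ 2 * D) :
    (q ^ 6 - 1) * (q ^ 4 + q ^ 3 + q ^ 2 + q + 1) * (q ^ 2 + 1) ∣ D := by
  have h1 : q - 1 ≠ 0 := by omega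
  have h2 : q + 1 ≠ 0 := by omega
  have c32 : IsCoprime (q ^ 2 + q + 1) (q + 1) := ⟨1, -q, by ring⟩
  have c34 : IsCoprime (q ^ 2 + q + 1) (q ^ 2 + 1) := ⟨-q, 1 + q, by ring⟩
  have c52 : IsCoprime (q ^ 4 + q ^ 3 + q ^ 2 + q + 1) (q + 1) := ⟨1, -(q ^ 3 + q), by ring⟩
  have c53 : IsCoprime (q ^ 4 + q ^ 3 + q ^ 2 + q + 1) (q ^ 2 + q + 1) :=
    ⟨-q, 1 + q ^ 3, by ring⟩
  have c54 : IsCoprime (q ^ 4 + q ^ 3 + q ^ 2 + q + 1) (q ^ 2 + 1) :=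
    ⟨1, -(q ^ 2 + q), by ring⟩
  have c61 : IsCoprime (q ^ 2 - q + 1) (q - 1) := ⟨1, -q, by ring⟩
  have c64 : IsCoprime (q ^ 2 - q + 1) (q ^ 2 + 1) := ⟨q, 1 - q, by ring⟩
  have c65 : IsCoprime (q ^ 2 - q + 1) (q ^ 4 + q ^ 3 + q ^ 2 + q + 1) :=
    ⟨q * (q + 1) ^ 2 + (q + 1), -q, by ring⟩
  have c62 : IsCoprime (q ^ 2 - q + 1) 2 := by
    obtain ⟨k, rfl⟩ := hq
    exact ⟨1, -(2 * k ^ 2 + k), by ring⟩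
  have c63 : IsCoprime (q ^ 2 - q + 1) (q ^ 2 + q + 1) := by
    have e : q ^ 2 + q + 1 = 2 * q + (q ^ 2 - q + 1) * 1 := by ring
    rw [e, IsCoprime.add_mul_left_right_iff]
    exact c62.mul_right ⟨1, 1 - q, by ring⟩
  have d1 : q - 1 ∣ D := Dvd.dvd.trans ⟨q ^ 2 + q + 1, by ring⟩ h3
  have d2 : q + 1 ∣ D := Dvd.dvd.trans ⟨(q - 1) * (q ^ 2 + 1), by ring⟩ h4
  have d5 : (q - 1) * (q ^ 4 + q ^ 3 + q ^ 2 + q + 1) ∣ D :=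
    mul_dvd_of_dvd_of_mul_dvd_mul h1 d1 (by convert h5 using 1; ring)
      (isCoprime_cyclotomic_five_six hq)
  have d6 : (q + 1) * (q ^ 2 - q + 1) ∣ D :=
    mul_dvd_of_dvd_of_mul_dvd_mul h2 d2 (by convert h6 using 1; ring) c62
  have d34 : (q - 1) * ((q ^ 2 + q + 1) * ((q + 1) * (q ^ 2 + 1))) ∣ D :=
    mul_mul_dvd_of_isCoprime h1 (by convert h3 using 1; ring) (by convert h4 using 1; ring)
      (c32.mul_right c34)
  have d345 := mul_mul_dvd_of_isCoprime h1 d5 d34 (c53.mul_right (c52.mul_right c54))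
  have := mul_mul_dvd_of_isCoprime
    (c := (q - 1) * (q ^ 4 + q ^ 3 + q ^ 2 + q + 1) * (q ^ 2 + q + 1) * (q ^ 2 + 1))
    h2 d6 (by convert d345 using 1; ring)
    (((c61.mul_right c65).mul_right c63).mul_right c64)
  convert this using 1
  ring

theorem psl6_exponent_eq {q : ℕ} (hq : 1 < q) :
    (q ^ 6 - 1) * (q ^ 5 - 1) * (q ^ 2 + 1) / (q - 1) =
      (q ^ 6 - 1) * (q ^ 4 + q ^ 3 + q ^ 2 + q + 1) * (q ^ 2 + 1) := by
  obtain ⟨t, rfl⟩ := Nat.exists_eq_add_of_lt hq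
  have h5 : (1 + t + 1) ^ 5 - 1 = (t + 1) * ((1 + t + 1) ^ 4 + (1 + t + 1) ^ 3 +
      (1 + t + 1) ^ 2 + (1 + t + 1) + 1) := Nat.sub_eq_of_eq_add (by ring)
  rw [h5, show 1 + t + 1 - 1 = t + 1 by omega]
  exact Nat.div_eq_of_eq_mul_right (by omega) (by ring)

theorem pow_sub_one_dvd_psl6_exponent {q i : ℕ} (hq : 1 < q) (hi : 0 < i) (hi6 : i ≤ 6) :
    q ^ i - 1 ∣ (q ^ 6 - 1) * (q ^ 4 + q ^ 3 + q ^ 2 + q + 1) * (q ^ 2 + 1) := by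
  have hdvd : ∀ j, j ∣ 6 → q ^ j - 1 ∣
      (q ^ 6 - 1) * (q ^ 4 + q ^ 3 + q ^ 2 + q + 1) * (q ^ 2 + 1) := by
    rintro j ⟨k, hk⟩
    rw [hk, pow_mul, mul_assoc]
    exact Dvd.dvd.mul_right (by simpa using Nat.sub_dvd_pow_sub_pow (q ^ j) 1 k) _
  obtain ⟨t, rfl⟩ := Nat.exists_eq_add_of_lt hq
  have h6 : (1 + t + 1) ^ 6 - 1 = (t + 1) * ((t + 3) * ((1 + t + 1) ^ 2 + (1 + t + 1) + 1) *
      ((1 + t) ^ 2 + (1 + t) + 1)) := Nat.sub_eq_of_eq_add (by ring)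
  interval_cases i
  · exact hdvd 1 (by norm_num)
  · exact hdvd 2 (by norm_num)
  · exact hdvd 3 (by norm_num)
  · have h4 : (1 + t + 1) ^ 4 - 1 = (t + 1) * ((t + 3) * ((1 + t + 1) ^ 2 + 1)) :=
      Nat.sub_eq_of_eq_add (by ring)
    rw [h4, h6]
    exact ⟨((1 + t + 1) ^ 2 + (1 + t + 1) + 1) * ((1 + t) ^ 2 + (1 + t) + 1) *
      ((1 + t + 1) ^ 4 + (1 + t + 1) ^ 3 + (1 + t + 1) ^ 2 + (1 + t + 1) + 1), by ring⟩
  · have h5 : (1 + t + 1) ^ 5 - 1 = (t + 1) * ((1 + t + 1) ^ 4 + (1 + t + 1) ^ 3 +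
        (1 + t + 1) ^ 2 + (1 + t + 1) + 1) := Nat.sub_eq_of_eq_add (by ring)
    rw [h5, h6]
    exact ⟨((t + 3) * ((1 + t + 1) ^ 2 + (1 + t + 1) + 1) * ((1 + t) ^ 2 + (1 + t) + 1)) *
      ((1 + t + 1) ^ 2 + 1), by ring⟩
  · exact hdvd 6 (by norm_num)

end Divisibility

section UpperBound

open Polynomial

theorem exists_dvd_pow_of_irreducible_dvd {α : Type*} [CommMonoidWithZero α]
    [UniqueFactorizationMonoid α] {a b : α} (ha : a ≠ 0)
    (h : ∀ f, Irreducible f → f ∣ a → f ∣ b) : ∃ k, a ∣ b ^ k := by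
  induction a using WfDvdMonoid.induction_on_irreducible with
  | zero => exact absurd rfl ha
  | unit u hu => exact ⟨0, hu.dvd⟩
  | mul a i ha0 hi ih =>
    obtain ⟨k, hk⟩ := ih ha0 fun f hf hfa => h f hf (hfa.mul_left i)
    exact ⟨k + 1, by
      rw [pow_succ']
      exact mul_dvd_mul (h i hi (dvd_mul_right i a)) hk⟩

theorem Irreducible.dvd_X_pow_card_pow_natDegree_sub_one {F : Type*} [Field F] [Finite F]
    {f : F[X]} (hf : Irreducible f) (hX : ¬ f ∣ X) :
    f ∣ X ^ (Nat.card F ^ f.natDegree - 1) - 1 := by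
  have h := hf.natDegree_dvd_iff_dvd_X_pow_card_pow_sub_X.1 dvd_rfl
  have hpos : 0 < Nat.card F ^ f.natDegree := pow_pos Nat.card_pos _
  have e : (X : F[X]) ^ Nat.card F ^ f.natDegree - X =
      X * (X ^ (Nat.card F ^ f.natDegree - 1) - 1) := by
    rw [mul_sub, ← pow_succ', Nat.sub_add_cancel hpos, mul_one]
  rw [e] at h
  exact (hf.prime.dvd_or_dvd h).resolve_left hX

theorem Matrix.isNilpotent_pow_sub_one_of_card_pow_sub_one_dvd {F : Type*} [Field F] [Finite F]
    {n : Type*} [Fintype n] [DecidableEq n] {A : Matrix n n F} (hA : A.det ≠ 0) {N : ℕ}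
    (hN : ∀ i, 0 < i → i ≤ Fintype.card n → Nat.card F ^ i - 1 ∣ N) :
    IsNilpotent (A ^ N - 1) := by
  obtain ⟨k, hk⟩ : ∃ k, A.charpoly ∣ (X ^ N - 1) ^ k := by
    refine exists_dvd_pow_of_irreducible_dvd A.charpoly_monic.ne_zero fun f hf hfA => ?_
    have hX : ¬ f ∣ X := by
      intro h
      have hX' := (hf.associated_of_dvd irreducible_X h).symm.dvd.trans hfA
      rw [X_dvd_iff] at hX'
      exact hA (by rw [Matrix.det_eq_sign_charpoly_coeff, hX', mul_zero])
    have hdeg : f.natDegree ≤ Fintype.card n :=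
      (natDegree_le_of_dvd hfA A.charpoly_monic.ne_zero).trans A.charpoly_natDegree_eq_dim.le
    obtain ⟨c, rfl⟩ := hN _ hf.natDegree_pos hdeg
    refine (hf.dvd_X_pow_card_pow_natDegree_sub_one hX).trans ?_
    simpa [pow_mul] using sub_dvd_pow_sub_pow
      ((X : F[X]) ^ (Nat.card F ^ f.natDegree - 1)) 1 c
  refine ⟨k, ?_⟩
  obtain ⟨g, hg⟩ := hk
  have := congrArg (aeval A) hg
  rwa [map_mul, A.aeval_self_charpoly, zero_mul, map_pow, map_sub, map_pow, aeval_X,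
    map_one] at this

theorem Matrix.ProjectiveSpecialLinearGroup.orderOf_dvd_of_coprime {F : Type*} [Field F] [Finite F]
    {p : ℕ} [Fact p.Prime] [CharP F p] {n : ℕ} {N : ℕ}
    (hN : ∀ i, 0 < i → i ≤ n → Nat.card F ^ i - 1 ∣ N) (g : PSL(n, F))
    (hg : (orderOf g).Coprime p) : orderOf g ∣ N := by
  obtain ⟨A, rfl⟩ := QuotientGroup.mk_surjective g
  obtain ⟨k, hk⟩ := Matrix.isNilpotent_pow_sub_one_of_card_pow_sub_one_dvd
    (A := (A : Matrix (Fin n) (Fin n) F)) (by simp) (N := N) (by simpa using hN)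
  have hkp : k ≤ p ^ k := (Nat.lt_pow_self (Fact.out : p.Prime).one_lt).le
  have hA : A ^ (N * p ^ k) = 1 := by
    apply Subtype.ext
    rcases isEmpty_or_nonempty (Fin n) with _ | _
    · exact Subsingleton.elim _ _
    have h := pow_eq_zero_of_le hkp hk
    rw [sub_pow_char_pow_of_commute _ _ (Commute.one_right _), one_pow, ← pow_mul,
      sub_eq_zero] at h
    simpa using h
  refine (Nat.Coprime.pow_right k hg).dvd_of_dvd_mul_right (orderOf_dvd_of_pow_eq_one ?_)
  rw [← QuotientGroup.mk_pow, hA, QuotientGroup.mk_one]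

end UpperBound

section LowerBound

theorem Algebra.norm_prod {R A B : Type*} [CommRing R] [Ring A] [Ring B] [Algebra R A]
    [Algebra R B] [Module.Free R A] [Module.Finite R A] [Module.Free R B] [Module.Finite R B]
    (x : A × B) : Algebra.norm R x = Algebra.norm R x.1 * Algebra.norm R x.2 := by
  simp only [Algebra.norm_apply]
  rw [← LinearMap.det_prodMap]
  rfl

/-- Multiplication by an element `u` of norm one is an element of the special linear group, whose
image in the projective special linear group has order `m` with `u ^ m` a scalar. -/
theorem exists_mem_specSet_of_norm_eq_one {F R : Type*} [Field F] [CommRing R] [Algebra F R]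
    [Module.Finite F R] {n : ℕ} (hn : Module.finrank F R = n) {u : R}
    (hu : Algebra.norm F u = 1) {k : ℕ} (huk : u ^ k = 1) :
    ∃ m ∈ specSet PSL(n, F), m ∣ k ∧ ∃ c : F, c ^ n = 1 ∧ u ^ m = algebraMap F R c := by
  let b := Module.finBasisOfFinrankEq F R hn
  let A : Matrix.SpecialLinearGroup (Fin n) F :=
    ⟨Algebra.leftMulMatrix b u, by rw [← Algebra.norm_eq_matrix_det, hu]⟩
  have hA : ∀ j, ((A ^ j : Matrix.SpecialLinearGroup (Fin n) F) : Matrix (Fin n) (Fin n) F) =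
      Algebra.leftMulMatrix b (u ^ j) := by
    intro j
    rw [Matrix.SpecialLinearGroup.coe_pow, map_pow]
  refine ⟨_, ⟨(A : PSL(n, F)), rfl⟩, orderOf_dvd_of_pow_eq_one ?_, ?_⟩
  · rw [← QuotientGroup.mk_pow, show A ^ k = 1 from Subtype.ext (by rw [hA, huk]; simp),
      QuotientGroup.mk_one]
  · have h := pow_orderOf_eq_one (A : PSL(n, F))
    rw [← QuotientGroup.mk_pow, QuotientGroup.eq_one_iff,
      Matrix.SpecialLinearGroup.mem_center_iff] at h
    obtain ⟨c, hc, hcA⟩ := h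
    refine ⟨c, by simpa using hc, Algebra.leftMulMatrix_injective b ?_⟩
    rw [← hA, ← hcA, AlgHom.commutes]
    rfl

/-- A finite field has an extension of every positive degree, with cyclic group of units. -/
theorem exists_extension_orderOf_unit_eq (F : Type*) [Field F] [Finite F] {i : ℕ} (hi : 0 < i) :
    ∃ (K : Type) (_ : Field K) (_ : Algebra F K) (_ : Module.Finite F K) (a : Kˣ),
      Module.finrank F K = i ∧ orderOf a = Nat.card F ^ i - 1 := by
  obtain ⟨p, hp⟩ := CharP.exists F
  have : Fact p.Prime := ⟨CharP.char_is_prime F p⟩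
  have : NeZero i := ⟨hi.ne'⟩
  obtain ⟨a, ha⟩ := IsCyclic.exists_ofOrder_eq_natCard (α := (FiniteField.Extension F p i)ˣ)
  exact ⟨FiniteField.Extension F p i, inferInstance, inferInstance, inferInstance, a,
    FiniteField.finrank_extension F p i,
    by rw [ha, Nat.card_units, FiniteField.natCard_extension]⟩

theorem Units.pow_val_eq_one_iff_orderOf_dvd {M : Type*} [Monoid M] {a : Mˣ} {k : ℕ} :
    (a : M) ^ k = 1 ↔ orderOf a ∣ k := by
  rw [orderOf_dvd_iff_pow_eq_one, ← Units.val_pow_eq_pow_val, Units.val_eq_one]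

variable (F : Type*) [Field F] [Finite F]

theorem card_pow_sub_one_mem_specSet {i n : ℕ} (hi : 0 < i) (hn : i + 2 ≤ n) :
    Nat.card F ^ i - 1 ∈ specSet PSL(n, F) := by
  obtain ⟨K, _, _, _, a, hK, ha⟩ := exists_extension_orderOf_unit_eq F hi
  obtain ⟨j, rfl⟩ := Nat.exists_eq_add_of_le hn
  have hN : Algebra.norm F (a : K) ≠ 0 := Algebra.norm_ne_zero_iff.2 a.ne_zero
  have hpow : (a : K) ^ (Nat.card F ^ i - 1) = 1 :=
    Units.pow_val_eq_one_iff_orderOf_dvd.2 ha.dvd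
  have hNpow : Algebra.norm F (a : K) ^ (Nat.card F ^ i - 1) = 1 := by
    rw [← map_pow, hpow, map_one]
  obtain ⟨m, hm, hmk, c, -, hc⟩ := exists_mem_specSet_of_norm_eq_one
    (R := K × F × F × (Fin j → F)) (F := F) (n := i + 2 + j)
    (by simp only [Module.finrank_prod, hK, Module.finrank_self, Module.finrank_fin_fun]; ring)
    (u := ((a : K), 1, (Algebra.norm F (a : K))⁻¹, 1))
    (by simp [Algebra.norm_prod, hN]) (k := Nat.card F ^ i - 1)
    (by simp [Prod.ext_iff, hpow, hNpow])
  have hc1 : c = 1 := by simpa using (congrArg (fun x => x.2.1) hc).symm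
  have ham : (a : K) ^ m = 1 := by simpa [hc1] using congrArg Prod.fst hc
  rw [Units.pow_val_eq_one_iff_orderOf_dvd, ha] at ham
  rwa [Nat.dvd_antisymm ham hmk]

theorem exists_mem_specSet_card_pow_sub_one_dvd_mul {n : ℕ} (hn : 0 < n) :
    ∃ m ∈ specSet PSL(n + 1, F), m ∣ Nat.card F ^ n - 1 ∧ Nat.card F ^ n - 1 ∣ (n + 1) * m := by
  obtain ⟨K, _, _, _, a, hK, ha⟩ := exists_extension_orderOf_unit_eq F hn
  have hN : Algebra.norm F (a : K) ≠ 0 := Algebra.norm_ne_zero_iff.2 a.ne_zero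
  have hpow : (a : K) ^ (Nat.card F ^ n - 1) = 1 :=
    Units.pow_val_eq_one_iff_orderOf_dvd.2 ha.dvd
  have hNpow : Algebra.norm F (a : K) ^ (Nat.card F ^ n - 1) = 1 := by
    rw [← map_pow, hpow, map_one]
  obtain ⟨m, hm, hmk, c, hcn, hc⟩ := exists_mem_specSet_of_norm_eq_one
    (R := K × F) (F := F) (n := n + 1)
    (by simp only [Module.finrank_prod, hK, Module.finrank_self])
    (u := ((a : K), (Algebra.norm F (a : K))⁻¹))
    (by simp [Algebra.norm_prod, hN]) (k := Nat.card F ^ n - 1)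
    (by simp [Prod.ext_iff, hpow, hNpow])
  refine ⟨m, hm, hmk, ?_⟩
  have ham : (a : K) ^ m = algebraMap F K c := by simpa using congrArg Prod.fst hc
  rw [← ha, ← Units.pow_val_eq_one_iff_orderOf_dvd, mul_comm, pow_mul, ham, ← map_pow, hcn,
    map_one]

theorem exists_mem_specSet_card_pow_add_one_dvd_two_mul {j : ℕ} (hj : 0 < j) :
    ∃ m ∈ specSet PSL(2 * j, F), m ∣ Nat.card F ^ j + 1 ∧ Nat.card F ^ j + 1 ∣ 2 * m := by
  have := Fintype.ofFinite F
  obtain ⟨K, _, _, _, a, hK, ha⟩ :=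
    exists_extension_orderOf_unit_eq F (i := 2 * j) (by omega)
  have hcard : 1 < Nat.card F ^ j := Nat.one_lt_pow hj.ne' Finite.one_lt_card
  have hfac : (Nat.card F ^ j - 1) * (Nat.card F ^ j + 1) = Nat.card F ^ (2 * j) - 1 := by
    rw [mul_comm 2 j, pow_mul, mul_comm, ← Nat.sq_sub_sq, one_pow]
  have hfrob : ∀ c : F, c ^ (Nat.card F ^ j) = c := fun c => by
    rw [Nat.card_eq_fintype_card, FiniteField.pow_card_pow]
  have hN : Algebra.norm F (a : K) ≠ 0 := Algebra.norm_ne_zero_iff.2 a.ne_zero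
  have hNpow : Algebra.norm F (a : K) ^ (Nat.card F ^ j - 1) = 1 := by
    refine mul_right_cancel₀ hN ?_
    rw [← pow_succ, Nat.sub_add_cancel hcard.le, hfrob, one_mul]
  have hpow : ((a : K) ^ (Nat.card F ^ j - 1)) ^ (Nat.card F ^ j + 1) = 1 := by
    rw [← pow_mul, Units.pow_val_eq_one_iff_orderOf_dvd, ha, hfac]
  obtain ⟨m, hm, hmk, c, -, hc⟩ := exists_mem_specSet_of_norm_eq_one hK
    (u := (a : K) ^ (Nat.card F ^ j - 1)) (by rw [map_pow, hNpow]) hpow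
  refine ⟨m, hm, hmk, ?_⟩
  have hc2 : c ^ 2 = 1 := by
    have : c ^ (Nat.card F ^ j + 1) = 1 := by
      refine (algebraMap F K).injective ?_
      rw [map_pow, ← hc, ← pow_mul, mul_comm, pow_mul, hpow, one_pow, map_one]
    rwa [pow_succ, hfrob, ← sq] at this
  have h1 : (a : K) ^ ((Nat.card F ^ j - 1) * (2 * m)) = 1 := by
    rw [pow_mul, mul_comm 2 m, pow_mul, hc, ← map_pow, hc2, map_one]
  rw [Units.pow_val_eq_one_iff_orderOf_dvd, ha, ← hfac] at h1
  exact Nat.dvd_of_mul_dvd_mul_left (by omega) h1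

end LowerBound

theorem exp_p'_psl6
    (p f q : ℕ) (hp : p.Prime) (hpodd : Odd p) (hf : 0 < f) (hq : q = p ^ f)
    (F : Type*) [Field F] [Fintype F] (hF : Fintype.card F = q) :
    (∀ m ∈ specSet PSL(6, F), Nat.Coprime m p →
      m ∣ (q ^ 6 - 1) * (q ^ 5 - 1) * (q ^ 2 + 1) / (q - 1)) ∧
    (∀ d : ℕ, (∀ m ∈ specSet PSL(6, F), Nat.Coprime m p → m ∣ d) →
      (q ^ 6 - 1) * (q ^ 5 - 1) * (q ^ 2 + 1) / (q - 1) ∣ d) := by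
  have : Fact p.Prime := ⟨hp⟩
  have hF' : Nat.card F = q := by rw [Nat.card_eq_fintype_card, hF]
  have : CharP F p := charP_of_card_eq_prime_pow (f := f) (by rw [hF, hq])
  have hq1 : 1 < q := hq ▸ Nat.one_lt_pow hf.ne' hp.one_lt
  have hqodd : Odd q := hq ▸ hpodd.pow
  have hpq : p ∣ q := hq ▸ dvd_pow_self p hf.ne'
  rw [psl6_exponent_eq hq1]
  refine ⟨?_, fun d hd => ?_⟩
  · rintro _ ⟨g, rfl⟩ hg
    exact Matrix.ProjectiveSpecialLinearGroup.orderOf_dvd_of_coprime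
      (fun i hi hi6 => hF'.symm ▸ pow_sub_one_dvd_psl6_exponent hq1 hi hi6) g hg
  · have hle : ∀ i, 1 ≤ q ^ i := fun i => Nat.one_le_pow _ _ (by omega)
    have hsub : ∀ i, 0 < i → (q ^ i - 1).Coprime p := fun i hi =>
      Nat.Coprime.coprime_dvd_right (hpq.trans (dvd_pow_self q hi.ne'))
        ((Nat.coprime_self_sub_left (hle i)).2 (Nat.coprime_one_left _))
    have hadd : (q ^ 3 + 1).Coprime p :=
      Nat.Coprime.coprime_dvd_right (hpq.trans (dvd_pow_self q three_ne_zero))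
        (Nat.coprime_self_add_left.2 (Nat.coprime_one_left _))
    have h4 : q ^ 4 - 1 ∣ d :=
      hd _ (hF' ▸ card_pow_sub_one_mem_specSet F (by norm_num) le_rfl) (hsub 4 (by norm_num))
    have h3 : q ^ 3 - 1 ∣ d :=
      hd _ (hF' ▸ card_pow_sub_one_mem_specSet F (by norm_num) (by norm_num))
        (hsub 3 (by norm_num))
    obtain ⟨m, hm, hmk, hkm⟩ := exists_mem_specSet_card_pow_sub_one_dvd_mul F (n := 5)
      (by norm_num)
    obtain ⟨l, hl, hlk, hkl⟩ := exists_mem_specSet_card_pow_add_one_dvd_two_mul F (j := 3)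
      (by norm_num)
    rw [hF'] at hmk hkm hlk hkl
    have h5 : q ^ 5 - 1 ∣ 6 * d := hkm.trans
      (mul_dvd_mul_left _ (hd m hm ((hsub 5 (by norm_num)).coprime_dvd_left hmk)))
    have h6 : q ^ 3 + 1 ∣ 2 * d := hkl.trans
      (mul_dvd_mul_left _ (hd l hl (hadd.coprime_dvd_left hlk)))
    zify [hle] at h3 h4 h5 h6 ⊢
    exact prod_cyclotomic_dvd (mod_cast hqodd) (mod_cast hq1) h4 h3 h5 h6
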